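/- Define K^c := {v ∈ M_1 × ⋯ × M_k : dim Q(v) = h + k} and assume K^c is nonempty. Let A := ⋂_{v ∈ K^c} Q(v) (a subspace of X), let γ := {j ∈ {1,…,k} : M_j ⊆ A} and l := card(γ). Then dim A ≤ h + l. -/

import Mathlib

open Module in
lemma aux_bound {n k : ℕ} (U : Submodule ℝ (Fin n → ℝ)) (v : Fin k → (Fin n → ℝ))
    (s : Finset (Fin k)) :
    finrank ℝ ↥(U ⊔ Submodule.span ℝ (v '' (s : Set (Fin k)))) ≤ finrank ℝ U + s.card := by
  classical
  have h1 := Submodule.finrank_add_le_finrank_add_finrank U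
    (Submodule.span ℝ (v '' (s : Set (Fin k))))
  have h2 : finrank ℝ (Submodule.span ℝ (v '' (s : Set (Fin k)))) ≤ s.card := by
    rw [← Finset.coe_image]
    exact (finrank_span_finset_le_card _).trans Finset.card_image_le
  omega

open Module in
lemma aux_eq {n k : ℕ} (W : Submodule ℝ (Fin n → ℝ)) (v : Fin k → (Fin n → ℝ))
    (hv : finrank ℝ ↥(W ⊔ Submodule.span ℝ (Set.range v)) = finrank ℝ ↥W + k)
    (s : Finset (Fin k)) :
    finrank ℝ ↥(W ⊔ Submodule.span ℝ (v '' (s : Set (Fin k)))) = finrank ℝ W + s.card := by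
  classical
  have h1 := aux_bound W v s
  have h2 := aux_bound (W ⊔ Submodule.span ℝ (v '' (s : Set (Fin k)))) v sᶜ
  rw [sup_assoc, ← Submodule.span_union, ← Set.image_union] at h2
  have h3 : (s : Set (Fin k)) ∪ ((sᶜ : Finset (Fin k)) : Set (Fin k)) = Set.univ := by
    simp
  rw [h3, Set.image_univ, hv] at h2
  have h4 := Finset.card_add_card_compl s
  simp only [Fintype.card_fin] at h4
  omega

open Module in
lemma aux_split {n : ℕ} (P : Submodule ℝ (Fin n → ℝ)) (hP : ¬ finrank ℝ P ≤ 1) :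
    ∃ N₁ N₂ : Submodule ℝ (Fin n → ℝ), N₁ < P ∧ N₂ < P ∧ N₁ ⊔ N₂ = P := by
  have hb : P ≠ ⊥ := by
    rintro rfl
    simp at hP
  obtain ⟨x, hx, hx0⟩ := Submodule.exists_mem_ne_zero_of_ne_bot hb
  have hle : Submodule.span ℝ {x} ≤ P := by simpa using hx
  obtain ⟨C, hC⟩ := exists_isCompl (Submodule.span ℝ {x})
  refine ⟨Submodule.span ℝ {x}, C ⊓ P, lt_of_le_of_ne hle ?_, lt_of_le_of_ne inf_le_right ?_, ?_⟩
  · intro h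
    apply hP
    rw [← h, finrank_span_singleton hx0]
  · intro h
    have h1 : P ≤ C := inf_eq_right.mp h
    have h2 := hC.disjoint.le_bot ⟨Submodule.mem_span_singleton_self x, h1 hx⟩
    exact hx0 (by simpa using h2)
  · rw [← sup_inf_assoc_of_le C hle, hC.sup_eq_top, top_inf_eq]

open Module in
lemma aux_sup_update {n k : ℕ} (M : Fin k → Submodule ℝ (Fin n → ℝ)) (j : Fin k)
    (N : Submodule ℝ (Fin n → ℝ)) (J : Finset (Fin k)) (hj : j ∉ J) :
    J.sup (Function.update M j N) = J.sup M := by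
  apply Finset.sup_congr rfl
  intro i hi
  rw [Function.update_of_ne]
  rintro rfl
  exact hj hi

open Module in
/-- If shrinking `M j` to `N` breaks Rado's condition, there is a witness avoiding `j`. -/
lemma aux_fail {n k : ℕ} (W : Submodule ℝ (Fin n → ℝ)) (M : Fin k → Submodule ℝ (Fin n → ℝ))
    (hR : ∀ J : Finset (Fin k), finrank ℝ W + J.card ≤ finrank ℝ ↥(W ⊔ J.sup M))
    (j : Fin k) (N : Submodule ℝ (Fin n → ℝ))
    (hf : ¬ ∀ J : Finset (Fin k), finrank ℝ W + J.card ≤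
      finrank ℝ ↥(W ⊔ J.sup (Function.update M j N))) :
    ∃ J : Finset (Fin k), j ∉ J ∧ finrank ℝ ↥(W ⊔ (N ⊔ J.sup M)) ≤ finrank ℝ W + J.card := by
  push Not at hf
  obtain ⟨J, hJ⟩ := hf
  by_cases hj : j ∈ J
  · refine ⟨J.erase j, Finset.notMem_erase j J, ?_⟩
    rw [← Finset.insert_erase hj, Finset.sup_insert, Function.update_self,
      aux_sup_update _ _ _ _ (Finset.notMem_erase j J),
      Finset.card_insert_of_notMem (Finset.notMem_erase j J)] at hJ
    omega
  · rw [aux_sup_update _ _ _ _ hj] at hJ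
    exact absurd (hR J) (by omega)

open Module in
/-- Rado's theorem for subspaces, relative to `W`. -/
lemma aux_rado {n k : ℕ} (W : Submodule ℝ (Fin n → ℝ)) (d : ℕ) :
    ∀ (M : Fin k → Submodule ℝ (Fin n → ℝ)), ∑ j, finrank ℝ (M j) = d →
    (∀ J : Finset (Fin k), finrank ℝ W + J.card ≤ finrank ℝ ↥(W ⊔ J.sup M)) →
    ∃ v : Fin k → (Fin n → ℝ), (∀ j, v j ∈ M j) ∧
      finrank ℝ ↥(W ⊔ Submodule.span ℝ (Set.range v)) = finrank ℝ ↥W + k := by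
  classical
  induction d using Nat.strong_induction_on with
  | _ d ih =>
  intro M hd hR
  by_cases h1 : ∀ j, finrank ℝ (M j) ≤ 1
  · have h2 : ∀ j, ∃ x, x ∈ M j ∧ M j ≤ Submodule.span ℝ {x} := by
      intro j
      obtain ⟨x, hx⟩ := finrank_le_one_iff.mp (h1 j)
      refine ⟨x, x.2, fun y hy => ?_⟩
      obtain ⟨c, hc⟩ := hx ⟨y, hy⟩
      exact Submodule.mem_span_singleton.mpr ⟨c, by simpa using congrArg Subtype.val hc⟩
    choose v hv hv2 using h2
    refine ⟨v, hv, le_antisymm ?_ ?_⟩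
    · have h3 := aux_bound W v Finset.univ
      rw [Finset.coe_univ, Set.image_univ, Finset.card_univ, Fintype.card_fin] at h3
      exact h3
    · have := hR Finset.univ
      rw [Finset.card_univ, Fintype.card_fin] at this
      refine this.trans (Submodule.finrank_mono (sup_le_sup_left ?_ W))
      refine Finset.sup_le fun j _ => (hv2 j).trans (Submodule.span_mono ?_)
      simp
  · push Not at h1
    obtain ⟨j, hj⟩ := h1
    obtain ⟨N₁, N₂, hN₁, hN₂, hN⟩ := aux_split (M j) (by omega)
    have key : ∀ N, N < M j → (∀ J : Finset (Fin k), finrank ℝ W + J.card ≤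
        finrank ℝ ↥(W ⊔ J.sup (Function.update M j N))) →
        ∃ v : Fin k → (Fin n → ℝ), (∀ j, v j ∈ M j) ∧
        finrank ℝ ↥(W ⊔ Submodule.span ℝ (Set.range v)) = finrank ℝ ↥W + k := by
      intro N hNM hRN
      have hle : ∀ i, Function.update M j N i ≤ M i := by
        intro i
        by_cases hi : i = j
        · subst hi
          simpa using hNM.le
        · simp [Function.update_of_ne hi]
      obtain ⟨v, hv, hv2⟩ := ih (∑ i, finrank ℝ (Function.update M j N i)) (by
        rw [← hd]
        refine Finset.sum_lt_sum (fun i _ => Submodule.finrank_mono (hle i))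
          ⟨j, Finset.mem_univ _, ?_⟩
        rw [Function.update_self]
        exact Submodule.finrank_lt_finrank_of_lt hNM) _ rfl hRN
      exact ⟨v, fun i => hle i (hv i), hv2⟩
    by_contra hcon
    obtain ⟨J₁, hj₁, hJ₁⟩ := aux_fail W M hR j N₁ fun h => hcon (key _ hN₁ h)
    obtain ⟨J₂, hj₂, hJ₂⟩ := aux_fail W M hR j N₂ fun h => hcon (key _ hN₂ h)
    have hs := Submodule.finrank_sup_add_finrank_inf_eq
      (W ⊔ (N₁ ⊔ J₁.sup M)) (W ⊔ (N₂ ⊔ J₂.sup M))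
    have ha := hR (insert j (J₁ ∪ J₂))
    have hb := hR (J₁ ∩ J₂)
    have ha' : W ⊔ (insert j (J₁ ∪ J₂)).sup M ≤
        (W ⊔ (N₁ ⊔ J₁.sup M)) ⊔ (W ⊔ (N₂ ⊔ J₂.sup M)) := by
      rw [Finset.sup_insert, Finset.sup_union, ← hN]
      apply le_of_eq
      simp only [sup_assoc, sup_left_comm, sup_left_idem]
    have hb' : W ⊔ (J₁ ∩ J₂).sup M ≤
        (W ⊔ (N₁ ⊔ J₁.sup M)) ⊓ (W ⊔ (N₂ ⊔ J₂.sup M)) :=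
      le_inf
        (sup_le_sup_left ((Finset.sup_mono Finset.inter_subset_left).trans le_sup_right) W)
        (sup_le_sup_left ((Finset.sup_mono Finset.inter_subset_right).trans le_sup_right) W)
    have ha2 := Submodule.finrank_mono ha'
    have hb2 := Submodule.finrank_mono hb'
    rw [Finset.card_insert_of_notMem (by simp [hj₁, hj₂])] at ha
    have hc := Finset.card_union_add_card_inter J₁ J₂
    omega

/-- Proposition fact:Adim: if `K^c` is nonempty, then the intersection
`A = ⋂_{v ∈ K^c} Q(v)` satisfies `dim A ≤ h + card{j : M_j ⊆ A}`. -/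
theorem dim_inter_le
    (n k : ℕ) (hk : 1 ≤ k) (W : Submodule ℝ (Fin n → ℝ))
    (M : Fin k → Submodule ℝ (Fin n → ℝ)) (hM : ∀ j, M j ≠ ⊥)
    (hne : ∃ v : Fin k → (Fin n → ℝ), (∀ j, v j ∈ M j) ∧
      Module.finrank ℝ ↥(W ⊔ Submodule.span ℝ (Set.range v)) =
        Module.finrank ℝ ↥W + k)
    (Asub : Submodule ℝ (Fin n → ℝ))
    (hA : Asub = ⨅ (v : Fin k → (Fin n → ℝ)) (_ : (∀ j, v j ∈ M j) ∧
        Module.finrank ℝ ↥(W ⊔ Submodule.span ℝ (Set.range v)) =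
          Module.finrank ℝ ↥W + k),
      W ⊔ Submodule.span ℝ (Set.range v))
    (γ : Finset (Fin k)) (hγ : ∀ j, j ∈ γ ↔ M j ≤ Asub) :
    Module.finrank ℝ ↥Asub ≤ Module.finrank ℝ ↥W + γ.card := by
  obtain ⟨v, hv, hvd⟩ := hne
  suffices h : Asub ≤ W ⊔ Submodule.span ℝ (v '' (γ : Set (Fin k))) from
    (Submodule.finrank_mono h).trans (aux_bound W v γ)
  intro a ha
  by_cases haW : a ∈ W
  · exact Submodule.mem_sup_left haW
  have hA' : ∀ u : Fin k → (Fin n → ℝ), (∀ j, u j ∈ M j) →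
      Module.finrank ℝ ↥(W ⊔ Submodule.span ℝ (Set.range u)) = Module.finrank ℝ ↥W + k →
      a ∈ W ⊔ Submodule.span ℝ (Set.range u) := by
    intro u hu hud
    rw [hA] at ha
    simp only [Submodule.mem_iInf] at ha
    exact ha u ⟨hu, hud⟩
  have hW' : Module.finrank ℝ ↥(W ⊔ Submodule.span ℝ {a}) = Module.finrank ℝ W + 1 := by
    apply le_antisymm
    · have h1 := Submodule.finrank_add_le_finrank_add_finrank W (Submodule.span ℝ {a})
      have h2 : Module.finrank ℝ (Submodule.span ℝ {a}) = 1 :=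
        finrank_span_singleton (by rintro rfl; exact haW W.zero_mem)
      omega
    · apply Submodule.finrank_lt_finrank_of_lt
      refine lt_of_le_of_ne le_sup_left fun h => haW ?_
      rw [h]
      exact Submodule.mem_sup_right (Submodule.mem_span_singleton_self a)
  have hJ : ∃ J : Finset (Fin k), Module.finrank ℝ ↥((W ⊔ Submodule.span ℝ {a}) ⊔ J.sup M) ≤
      Module.finrank ℝ W + J.card := by
    by_contra hcon
    push Not at hcon
    obtain ⟨u, hu, hud⟩ := aux_rado (W ⊔ Submodule.span ℝ {a}) _ M rfl (fun J => by
      have := hcon J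
      omega)
    have h1 := aux_bound W u Finset.univ
    rw [Finset.coe_univ, Set.image_univ, Finset.card_univ, Fintype.card_fin] at h1
    have h2 := Submodule.finrank_add_le_finrank_add_finrank
      (W ⊔ Submodule.span ℝ (Set.range u)) (Submodule.span ℝ {a})
    have h3 : Module.finrank ℝ (Submodule.span ℝ {a}) = 1 :=
      finrank_span_singleton (by rintro rfl; exact haW W.zero_mem)
    have h4 := hud
    rw [sup_right_comm] at h4
    have h5 := hA' u hu (by omega)
    have h6 : Submodule.span ℝ {a} ≤ W ⊔ Submodule.span ℝ (Set.range u) := by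
      simpa using h5
    rw [sup_eq_left.mpr h6] at h4
    omega
  obtain ⟨J, hJ⟩ := hJ
  have hEq : ∀ u : Fin k → (Fin n → ℝ), (∀ j, u j ∈ M j) →
      Module.finrank ℝ ↥(W ⊔ Submodule.span ℝ (Set.range u)) = Module.finrank ℝ ↥W + k →
      W ⊔ Submodule.span ℝ (u '' (J : Set (Fin k))) =
        (W ⊔ Submodule.span ℝ {a}) ⊔ J.sup M := by
    intro u hu hud
    apply Submodule.eq_of_le_of_finrank_le
    · refine sup_le_sup le_sup_left (Submodule.span_le.mpr ?_)
      rintro _ ⟨j, hj, rfl⟩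
      exact Finset.le_sup (f := M) hj (hu j)
    · rw [aux_eq W u hud J]
      exact hJ
  have hJγ : J ⊆ γ := by
    intro j hj
    rw [hγ, hA]
    refine le_iInf fun u => le_iInf fun hu => ?_
    calc M j ≤ (W ⊔ Submodule.span ℝ {a}) ⊔ J.sup M :=
          (Finset.le_sup (f := M) hj).trans le_sup_right
      _ = W ⊔ Submodule.span ℝ (u '' (J : Set (Fin k))) := (hEq u hu.1 hu.2).symm
      _ ≤ _ := sup_le_sup_left (Submodule.span_mono (Set.image_subset_range _ _)) W
  have h7 : a ∈ W ⊔ Submodule.span ℝ (v '' (J : Set (Fin k))) := by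
    rw [hEq v hv hvd]
    exact Submodule.mem_sup_left (Submodule.mem_sup_right (Submodule.mem_span_singleton_self a))
  exact sup_le_sup_left (Submodule.span_mono (Set.image_mono (by exact_mod_cast hJγ))) W h7
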